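/- Suppose S is smooth and let 1 ≤ i ≤ n−p with 2i+2 > n−p. Then there exists a nonempty Zariski open subset U_i of full-rank matrices of ℂ^{(n−p−i+1)×n} such that for every a ∈ U_i: Σ^{(j)}(π_a) = ∅ for all i < j ≤ n−p, the identity W_{K(\underline a)}(S) ∩ S_reg = Σ^{(i)}(π_a) holds, and W_{K(\underline a)}(S) ∩ S_reg is empty or a smooth subvariety of S of codimension i. -/

import Mathlib

open MvPolynomial

noncomputable section

/-- The Zariski closure of a subset of the affine space `σ → ℂ`. -/
def zcl {σ : Type} (T : Set (σ → ℂ)) : Set (σ → ℂ) :=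
  MvPolynomial.zeroLocus ℂ (MvPolynomial.vanishingIdeal ℂ T)

/-- Zariski open subsets of the affine space `σ → ℂ`. -/
def ZOpen {σ : Type} (U : Set (σ → ℂ)) : Prop :=
  ∃ I : Ideal (MvPolynomial σ ℂ), U = {x | ∃ f ∈ I, MvPolynomial.eval x f ≠ 0}

/-- Zariski open subsets of the space of `m × n` complex matrices. -/
def ZOpenMat {m n : ℕ} (U : Set (Matrix (Fin m) (Fin n) ℂ)) : Prop :=
  ∃ I : Ideal (MvPolynomial (Fin m × Fin n) ℂ),
    U = {a | ∃ f ∈ I, MvPolynomial.eval (fun q => a q.1 q.2) f ≠ 0}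

/-- `T` is of pure dimension `d`: every irreducible component of (the Zariski closure of) `T`,
i.e. every minimal prime over its vanishing ideal, has coordinate ring of Krull dimension `d`. -/
def IsPureDim {σ : Type} (T : Set (σ → ℂ)) (d : ℕ) : Prop :=
  ∀ P ∈ (MvPolynomial.vanishingIdeal ℂ T).minimalPrimes,
    ringKrullDim (MvPolynomial σ ℂ ⧸ P) = (d : WithBot (WithTop ℕ))

/-- The Zariski tangent space at a point `x` of (the Zariski closure of) a subset `T`
of affine space: the common kernel of the differentials at `x` of all polynomials
vanishing on `T`. -/
def tangentAt {σ : Type} [Fintype σ] [DecidableEq σ] (T : Set (σ → ℂ)) (x : σ → ℂ) :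
    Submodule ℂ (σ → ℂ) :=
  ⨅ (f : MvPolynomial σ ℂ) (_ : f ∈ MvPolynomial.vanishingIdeal ℂ T),
    LinearMap.ker
      (∑ l, MvPolynomial.eval x (MvPolynomial.pderiv l f) •
        (LinearMap.proj l : (σ → ℂ) →ₗ[ℂ] ℂ))

/-- `rs` is a regular sequence in the commutative ring `R`. -/
def IsRegSeq {R : Type*} [CommRing R] (rs : List R) : Prop :=
  Ideal.span {x | x ∈ rs} ≠ ⊤ ∧
  ∀ j, j < rs.length → ∀ b : R,
    rs.getD j 0 * b ∈ Ideal.span {x | x ∈ rs.take j} →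
    b ∈ Ideal.span {x | x ∈ rs.take j}

/-- The common zero set in `ℂⁿ` of polynomials `F₁, …, F_p ∈ ℚ[X₁, …, Xₙ]`. -/
def zeroSetC {n p : ℕ} (F : Fin p → MvPolynomial (Fin n) ℚ) : Set (Fin n → ℂ) :=
  {x | ∀ k, MvPolynomial.aeval x (F k) = 0}

/-- The Jacobian matrix `[∂F_k/∂X_l]` evaluated at `x ∈ ℂⁿ`. -/
def jacC {n p : ℕ} (F : Fin p → MvPolynomial (Fin n) ℚ) (x : Fin n → ℂ) :
    Matrix (Fin p) (Fin n) ℂ :=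
  Matrix.of fun k l => MvPolynomial.aeval x (MvPolynomial.pderiv l (F k))

/-- The set of regular points of `S = {F₁ = 0, …, F_p = 0}`: points of `S` where the
Jacobian has maximal rank `p`. -/
def SregC {n p : ℕ} (F : Fin p → MvPolynomial (Fin n) ℚ) : Set (Fin n → ℂ) :=
  {x | x ∈ zeroSetC F ∧ (jacC F x).rank = p}

/-- The classic polar variety: the Zariski closure of the locus of regular points of `S`
where the matrix obtained by appending the rows of `a` to the Jacobian has rank at
most `r` (i.e. where all `(r+1)`-minors vanish). -/
def Wclassic {n p m : ℕ} (F : Fin p → MvPolynomial (Fin n) ℚ)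
    (a : Matrix (Fin m) (Fin n) ℂ) (r : ℕ) : Set (Fin n → ℂ) :=
  zcl {x | x ∈ SregC F ∧ (Matrix.fromRows (jacC F x) a).rank ≤ r}

/-- The dual polar variety: as `Wclassic`, with appended rows `(a_{k,1} - X₁, …, a_{k,n} - Xₙ)`. -/
def Wdual {n p m : ℕ} (F : Fin p → MvPolynomial (Fin n) ℚ)
    (a : Matrix (Fin m) (Fin n) ℂ) (r : ℕ) : Set (Fin n → ℂ) :=
  zcl {x | x ∈ SregC F ∧
    (Matrix.fromRows (jacC F x) (Matrix.of fun k l => a k l - x l)).rank ≤ r}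

/-- `F₁, …, F_p` generate the full vanishing ideal of their zero set (over `ℂ`);
this encodes that `(F₁, …, F_p)` is reduced (radical) and the ideal of definition of `S`. -/
def idealOfDef {n p : ℕ} (F : Fin p → MvPolynomial (Fin n) ℚ) : Prop :=
  MvPolynomial.vanishingIdeal ℂ (zeroSetC F) =
    Ideal.span (Set.range fun k => MvPolynomial.map (algebraMap ℚ ℂ) (F k))

/-- The submatrix of the first `m` rows of a matrix. -/
def firstRows {N n' m : ℕ} (a : Matrix (Fin N) (Fin n') ℂ) (h : m ≤ N) :
    Matrix (Fin m) (Fin n') ℂ :=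
  Matrix.of fun k l => a (Fin.castLE h k) l

/-- The matrix obtained by deleting row `h`. -/
def rowErase {m n' : ℕ} (a : Matrix (Fin (m + 1)) (Fin n') ℂ) (h : Fin (m + 1)) :
    Matrix (Fin m) (Fin n') ℂ :=
  Matrix.of fun k l => a (h.succAbove k) l

/-- The real trace `S_ℝ := S ∩ ℝⁿ`, as a subset of Euclidean space. -/
def SR {n p : ℕ} (F : Fin p → MvPolynomial (Fin n) ℚ) : Set (EuclideanSpace ℝ (Fin n)) :=
  {x | (fun j => (x j : ℂ)) ∈ zeroSetC F}

/-- `C` is a connected component of `T`. -/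
def IsConnCompOf {α : Type*} [TopologicalSpace α] (C T : Set α) : Prop :=
  C.Nonempty ∧ C ⊆ T ∧ IsPreconnected C ∧
    ∀ D, C ⊆ D → D ⊆ T → IsPreconnected D → D = C

end

/-- The Thom–Boardman stratum \`Σ^{(j)}(π_a)\`: the set of regular points of \`S\` at which
the kernel of the differential of \`π_a\` (the linear map induced by \`a\`) restricted to the
Zariski tangent space of \`S\` has dimension \`j\`. -/
noncomputable def SigmaStr {n p m : ℕ} (F : Fin p → MvPolynomial (Fin n) ℚ)
    (a : Matrix (Fin m) (Fin n) ℂ) (j : ℕ) : Set (Fin n → ℂ) :=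
  {x | x ∈ SregC F ∧
    Module.finrank ℂ
      ↥(tangentAt (zeroSetC F) x ⊓ LinearMap.ker (Matrix.mulVecLin a)) = j}

theorem exists_ringHom_trivSqZeroExt_of_formallySmooth {A B : Type*} [CommRing A] [CommRing B]
    [Algebra A B] [Algebra.FormallySmooth A B] (φ : A →+* TrivSqZeroExt B B)
    (hφ : ∀ a, (φ a).fst = algebraMap A B a) :
    ∃ s : B →+* TrivSqZeroExt B B, (∀ b, (s b).fst = b) ∧ ∀ a, s (algebraMap A B a) = φ a := by
  let _ : Algebra A (TrivSqZeroExt B B) := φ.toAlgebra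
  let g : TrivSqZeroExt B B →ₐ[A] B :=
    { (TrivSqZeroExt.fstHom B B B).toRingHom with commutes' := hφ }
  have hg : Function.Surjective g := fun b => ⟨TrivSqZeroExt.inl b, rfl⟩
  have hnil : IsNilpotent (RingHom.ker (g : TrivSqZeroExt B B →+* B)) := by
    refine ⟨2, ?_⟩
    rw [Submodule.pow_succ, Submodule.pow_one, Ideal.zero_eq_bot, eq_bot_iff, Ideal.mul_le]
    intro x hx y hy
    have hx' : x.fst = 0 := hx
    have hy' : y.fst = 0 := hy
    rw [Ideal.mem_bot]
    ext <;> simp [hx', hy']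
  let s := Algebra.FormallySmooth.liftOfSurjective (AlgHom.id A B) g hg hnil
  refine ⟨s.toRingHom, fun b => ?_, fun a => s.commutes a⟩
  exact Algebra.FormallySmooth.liftOfSurjective_apply (AlgHom.id A B) g hg hnil b

theorem formallySmooth_mvPolynomial_of_field {τ κ : Type*} [Finite τ] [Field κ] [Algebra ℂ κ]
    [Algebra (MvPolynomial τ ℂ) κ] [IsScalarTower ℂ (MvPolynomial τ ℂ) κ]
    [Algebra.EssFiniteType ℂ κ] (h : Function.Injective (algebraMap (MvPolynomial τ ℂ) κ)) :
    Algebra.FormallySmooth (MvPolynomial τ ℂ) κ := by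
  have : FaithfulSMul (MvPolynomial τ ℂ) κ := (faithfulSMul_iff_algebraMap_injective _ _).2 h
  let K := FractionRing (MvPolynomial τ ℂ)
  let _ : Algebra K κ := FractionRing.liftAlgebra (MvPolynomial τ ℂ) κ
  have : IsScalarTower (MvPolynomial τ ℂ) K κ := inferInstance
  have : IsScalarTower ℂ K κ := IsScalarTower.to₁₃₄ ℂ (MvPolynomial τ ℂ) K κ
  have : Algebra.EssFiniteType K κ := Algebra.EssFiniteType.of_comp ℂ K κ
  have : CharZero K := charZero_of_injective_algebraMap (algebraMap ℂ K).injective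
  have : Algebra.FormallySmooth (MvPolynomial τ ℂ) K :=
    .of_isLocalization (nonZeroDivisors (MvPolynomial τ ℂ))
  have : Algebra.FormallySmooth K κ := inferInstance
  exact .comp (MvPolynomial τ ℂ) K κ

theorem snd_aeval_inl_add_inr {σ B : Type*} [Fintype σ] [CommRing B] [Algebra ℂ B]
    (z v : σ → B) (f : MvPolynomial σ ℂ) :
    aeval (fun w => (TrivSqZeroExt.inl (z w) + TrivSqZeroExt.inr (v w) : TrivSqZeroExt B B)) f =
      TrivSqZeroExt.inl (aeval z f) +
        TrivSqZeroExt.inr (∑ w, aeval z (pderiv w f) * v w) := by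
  classical
  induction f using MvPolynomial.induction_on with
  | C a => simp [TrivSqZeroExt.algebraMap_eq_inl']
  | add p q hp hq =>
    simp only [map_add, hp, hq, add_mul, Finset.sum_add_distrib, TrivSqZeroExt.inl_add,
      TrivSqZeroExt.inr_add]
    abel
  | mul_X p i hp =>
    rw [map_mul, hp]
    ext
    · simp
    · simp only [aeval_X, TrivSqZeroExt.snd_mul, TrivSqZeroExt.fst_add, TrivSqZeroExt.fst_inl,
        TrivSqZeroExt.fst_inr, add_zero, TrivSqZeroExt.snd_add, TrivSqZeroExt.snd_inl,
        TrivSqZeroExt.snd_inr, zero_add, smul_eq_mul, MulOpposite.smul_eq_mul_unop,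
        MulOpposite.unop_op, Derivation.leibniz, pderiv_X, map_add, map_mul, add_mul,
        Finset.sum_add_distrib, Finset.sum_mul]
      simp [Pi.single_apply, apply_ite, mul_comm, mul_left_comm, add_comm]

theorem Ideal.exists_notMem_forall_mul_mem_of_mem_minimalPrimes {R : Type*} [CommRing R]
    [IsNoetherianRing R] {I P : Ideal R} (hI : I.IsRadical) (hP : P ∈ I.minimalPrimes) :
    ∃ u ∉ P, ∀ x ∈ P, u * x ∈ I := by
  classical
  have hfin := I.finite_minimalPrimes_of_isNoetherianRing
  have hPp : P.IsPrime := hP.1.1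
  have hnot : ¬ (hfin.toFinset.erase P).inf id ≤ P := by
    rw [Ideal.IsPrime.inf_le' hPp]
    rintro ⟨P', hP', hle⟩
    rw [Finset.mem_erase, Set.Finite.mem_toFinset] at hP'
    exact hP'.1 (le_antisymm hle (hP.2 hP'.2.1 hle))
  obtain ⟨u, hu, huP⟩ := Set.not_subset.1 hnot
  refine ⟨u, huP, fun x hx => ?_⟩
  rw [← hI.radical, ← Ideal.sInf_minimalPrimes, Submodule.mem_sInf]
  intro P' hP'
  by_cases h : P' = P
  · exact h ▸ P.mul_mem_left u hx
  · refine Ideal.mul_mem_right x P' ?_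
    have := (Finset.inf_le (f := id) (s := hfin.toFinset.erase P) (b := P') (by simp [h, hP']) :
      (hfin.toFinset.erase P).inf id ≤ P')
    exact this hu

theorem isRadical_vanishingIdeal {σ : Type*} (V : Set (σ → ℂ)) :
    (vanishingIdeal ℂ V).IsRadical := by
  rintro f ⟨k, hk⟩ x hx
  have := hk x hx
  rw [map_pow] at this
  exact eq_zero_of_pow_eq_zero this

/-- The differential at `z` of polynomials, as linear forms on affine space. -/
noncomputable def differentialAt {σ : Type*} [Fintype σ] (z : σ → ℂ) :
    MvPolynomial σ ℂ →ₗ[ℂ] Module.Dual ℂ (σ → ℂ) where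
  toFun f := ∑ l, eval z (pderiv l f) • (LinearMap.proj l : (σ → ℂ) →ₗ[ℂ] ℂ)
  map_add' f g := by simp [add_smul, Finset.sum_add_distrib]
  map_smul' c f := by simp [Finset.smul_sum, smul_smul]

theorem differentialAt_apply {σ : Type*} [Fintype σ] (z v : σ → ℂ) (f : MvPolynomial σ ℂ) :
    differentialAt z f v = ∑ l, eval z (pderiv l f) * v l := by
  simp [differentialAt]

theorem differentialAt_mul {σ : Type*} [Fintype σ] (z : σ → ℂ) (f g : MvPolynomial σ ℂ) :
    differentialAt z (f * g) = eval z f • differentialAt z g + eval z g • differentialAt z f := by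
  ext v
  simp only [differentialAt_apply, Derivation.leibniz, smul_eq_mul, map_add, map_mul, add_mul,
    Finset.sum_add_distrib, LinearMap.add_apply, LinearMap.smul_apply, Finset.mul_sum, mul_assoc]

theorem differentialAt_X {σ : Type*} [Fintype σ] (z : σ → ℂ) (w : σ) :
    differentialAt z (X w) = LinearMap.proj w := by
  classical
  ext v
  simp [differentialAt_apply, pderiv_X, Pi.single_apply, apply_ite]

theorem differentialAt_C {σ : Type*} [Fintype σ] (z : σ → ℂ) (c : ℂ) :
    differentialAt z (C c) = 0 := by
  ext v
  simp [differentialAt_apply]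

theorem differentialAt_rename {σ τ : Type*} [Fintype σ] [Fintype τ] (z v : τ → ℂ) (e : σ → τ)
    (f : MvPolynomial σ ℂ) :
    differentialAt z (rename e f) v = differentialAt (z ∘ e) f (v ∘ e) := by
  induction f using MvPolynomial.induction_on with
  | C a => simp [differentialAt_C]
  | add p q hp hq => simp [hp, hq]
  | mul_X p i hp => simp [differentialAt_mul, differentialAt_X, hp, eval_rename]

theorem exists_formal_tangent_lift {σ τ κ : Type*} [Fintype σ] [Fintype τ] [Field κ]
    [Algebra ℂ κ] [Algebra.EssFiniteType ℂ κ] (ψ : MvPolynomial (σ ⊕ τ) ℂ →ₐ[ℂ] κ)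
    (hinj : Function.Injective (ψ.comp (rename (Sum.inr : τ → σ ⊕ τ)))) (α : τ → ℂ) :
    ∃ v : σ ⊕ τ → κ, (∀ t, v (Sum.inr t) = algebraMap ℂ κ (α t)) ∧
      ∀ g, ψ g = 0 → ∑ w, ψ (pderiv w g) * v w = 0 := by
  let _ : Algebra (MvPolynomial τ ℂ) κ :=
    (ψ.comp (rename (Sum.inr : τ → σ ⊕ τ))).toRingHom.toAlgebra
  have hmap : ∀ f : MvPolynomial τ ℂ,
    algebraMap (MvPolynomial τ ℂ) κ f = ψ (rename Sum.inr f) := fun _ => rfl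
  have : IsScalarTower ℂ (MvPolynomial τ ℂ) κ :=
    IsScalarTower.of_algebraMap_eq fun c => by
      rw [hmap]
      simp only [AlgHom.commutes]
  have := formallySmooth_mvPolynomial_of_field (τ := τ) (κ := κ) hinj
  let φ : MvPolynomial τ ℂ →ₐ[ℂ] TrivSqZeroExt κ κ := aeval fun t =>
    TrivSqZeroExt.inl (ψ (X (Sum.inr t))) + TrivSqZeroExt.inr (algebraMap ℂ κ (α t))
  have hφ : ∀ f, (φ f).fst = algebraMap (MvPolynomial τ ℂ) κ f := fun f => by
    have : ((TrivSqZeroExt.fstHom ℂ κ κ).comp φ) = ψ.comp (rename Sum.inr) := by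
      ext t
      simp [φ]
    exact DFunLike.congr_fun this f
  obtain ⟨s, hs1, hs2⟩ := exists_ringHom_trivSqZeroExt_of_formallySmooth φ.toRingHom hφ
  have hs3 : ∀ c : ℂ, s (algebraMap ℂ κ c) = algebraMap ℂ _ c := fun c => by
    have := hs2 (algebraMap ℂ _ c)
    rw [← IsScalarTower.algebraMap_apply] at this
    exact this.trans (φ.commutes c)
  let s' : κ →ₐ[ℂ] TrivSqZeroExt κ κ := { s with commutes' := hs3 }
  have hss : ∀ x, s' x = s x := fun _ => rfl
  have hψa : ∀ f, ψ f = aeval (fun w => ψ (X w)) f := fun f =>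
    DFunLike.congr_fun (aeval_unique ψ) f
  refine ⟨fun w => (s (ψ (X w))).snd, fun t => ?_, fun g hg => ?_⟩
  · have h1 : s (ψ (X (Sum.inr t))) = φ (X t) := by
      have := hs2 (X t)
      rwa [hmap, rename_X] at this
    simp [h1, φ, Algebra.algebraMap_eq_smul_one]
  · have h1 := congrArg s' hg
    rw [map_zero, hψa, comp_aeval_apply] at h1
    have h2 : (fun w => s' (ψ (X w))) = fun w => (TrivSqZeroExt.inl (ψ (X w)) +
        TrivSqZeroExt.inr (s (ψ (X w))).snd : TrivSqZeroExt κ κ) := by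
      funext w
      have h3 := hs1 (ψ (X w))
      ext
      · simp [h3, hss]
      · simp [hss]
    rw [h2, snd_aeval_inl_add_inr] at h1
    have := congrArg TrivSqZeroExt.snd h1
    simpa [← hψa] using this

theorem exists_tangent_lift_of_direction {σ τ ι : Type*} [Fintype σ] [Fintype τ] [Finite ι]
    (G : ι → MvPolynomial (σ ⊕ τ) ℂ) (α : τ → ℂ) :
    ∃ f : MvPolynomial τ ℂ, f ≠ 0 ∧ ∀ z : σ ⊕ τ → ℂ, eval (z ∘ Sum.inr) f ≠ 0 →
      (∀ j, eval z (G j) = 0) →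
      ∃ v : σ ⊕ τ → ℂ, (∀ t, v (Sum.inr t) = α t) ∧ ∀ j, differentialAt z (G j) v = 0 := by
  classical
  have := Fintype.ofFinite ι
  by_contra! H
  set V : Set (σ ⊕ τ → ℂ) := {z | (∀ j, eval z (G j) = 0) ∧
    ∀ v : σ ⊕ τ → ℂ, (∀ t, v (Sum.inr t) = α t) → ∃ j, differentialAt z (G j) v ≠ 0} with hV
  set I := vanishingIdeal ℂ V with hI
  let r : MvPolynomial τ ℂ →ₐ[ℂ] MvPolynomial (σ ⊕ τ) ℂ := rename Sum.inr
  have hdisj : Disjoint (I : Set (MvPolynomial (σ ⊕ τ) ℂ))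
      ((nonZeroDivisors (MvPolynomial τ ℂ)).map r.toRingHom.toMonoidHom :
        Submonoid (MvPolynomial (σ ⊕ τ) ℂ)) := by
    rw [Set.disjoint_left]
    rintro _ hx ⟨f, hf, rfl⟩
    obtain ⟨z, hz, hz1, hz2⟩ := H f (nonZeroDivisors.ne_zero hf)
    apply hz
    have := hx z ⟨hz1, hz2⟩
    simpa [r, aeval_eq_eval, eval_rename] using this
  obtain ⟨P₀, hP₀, hIP₀, hd₀⟩ := Ideal.exists_le_prime_disjoint I _ hdisj
  obtain ⟨P, hP, hPP₀⟩ := Ideal.exists_minimalPrimes_le hIP₀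
  have hPp : P.IsPrime := hP.1.1
  have hIP : I ≤ P := hP.1.2
  obtain ⟨u, huP, hu⟩ := Ideal.exists_notMem_forall_mul_mem_of_mem_minimalPrimes
    (isRadical_vanishingIdeal V) hP
  let Q := MvPolynomial (σ ⊕ τ) ℂ ⧸ P
  let κ := FractionRing Q
  let ψ : MvPolynomial (σ ⊕ τ) ℂ →ₐ[ℂ] κ :=
    (IsScalarTower.toAlgHom ℂ Q κ).comp (Ideal.Quotient.mkₐ ℂ P)
  have hψ : ∀ f, ψ f = 0 ↔ f ∈ P := fun f => by
    change algebraMap Q κ (Ideal.Quotient.mk P f) = 0 ↔ _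
    rw [map_eq_zero_iff _ (IsFractionRing.injective Q κ), Ideal.Quotient.eq_zero_iff_mem]
  have hinj : Function.Injective (ψ.comp r) := by
    rw [injective_iff_map_eq_zero]
    intro f hf
    by_contra hne
    rw [AlgHom.comp_apply, hψ] at hf
    exact Set.disjoint_left.1 hd₀ (hPP₀ hf) ⟨f, mem_nonZeroDivisors_of_ne_zero hne, rfl⟩
  have : Algebra.EssFiniteType ℂ κ := Algebra.EssFiniteType.comp ℂ Q κ
  obtain ⟨v, hv, hvrel⟩ := exists_formal_tangent_lift ψ hinj α
  have hrel : ∀ j, ∑ w, ψ (pderiv w (G j)) * v w = 0 := fun j =>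
    hvrel _ ((hψ _).2 (hIP fun z hz => hz.1 j))
  obtain ⟨b, hb⟩ := IsLocalization.exist_integer_multiples_of_finite (nonZeroDivisors Q) v
  choose c' hc' using hb
  obtain ⟨b₀, hb₀⟩ := Ideal.Quotient.mk_surjective (b : Q)
  choose c hc using fun w => Ideal.Quotient.mk_surjective (c' w)
  have hc2 : ∀ w, ψ (c w) = ψ b₀ * v w := fun w => by
    have h1 : ψ (c w) = algebraMap Q κ (c' w) := by rw [← hc]; rfl
    have h2 : ψ b₀ = algebraMap Q κ b := by rw [← hb₀]; rfl
    rw [h1, h2, hc']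
    exact Algebra.smul_def (b : Q) (v w)
  have hb₀P : b₀ ∉ P := fun h => by
    rw [← Ideal.Quotient.eq_zero_iff_mem, hb₀] at h
    exact nonZeroDivisors.coe_ne_zero b h
  have hr1 : ∀ j, ∑ w, pderiv w (G j) * c w ∈ P := fun j => by
    rw [← hψ, map_sum]
    simp_rw [map_mul, hc2]
    rw [← mul_zero (ψ b₀), ← hrel j, Finset.mul_sum]
    exact Finset.sum_congr rfl fun _ _ => by ring
  have hr2 : ∀ t, c (Sum.inr t) - b₀ * C (α t) ∈ P := fun t => by
    rw [← hψ, map_sub, map_mul, hc2, hv, ← algebraMap_eq, AlgHom.commutes, sub_self]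
  have hub : u * b₀ ∉ I := fun h => (hPp.mem_or_mem (hIP h)).elim huP hb₀P
  obtain ⟨z, hzV, hz⟩ : ∃ z ∈ V, eval z (u * b₀) ≠ 0 := by
    by_contra! h
    exact hub fun z hz => h z hz
  rw [map_mul, mul_ne_zero_iff] at hz
  obtain ⟨j, hj⟩ := hzV.2 (fun w => (eval z b₀)⁻¹ * eval z (c w)) fun t => by
    have h1 : eval z (u * (c (Sum.inr t) - b₀ * C (α t))) = 0 := hu _ (hr2 t) z hzV
    simp only [map_mul, map_sub, eval_C, mul_eq_zero, hz.1, false_or, sub_eq_zero] at h1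
    rw [h1]
    field_simp [hz.2]
  apply hj
  have h1 : eval z (u * ∑ w, pderiv w (G j) * c w) = 0 := hu _ (hr1 j) z hzV
  simp only [map_mul, mul_eq_zero, hz.1, false_or, map_sum] at h1
  rw [differentialAt_apply, ← mul_zero (eval z b₀)⁻¹, ← h1, Finset.mul_sum]
  exact Finset.sum_congr rfl fun _ _ => by ring

theorem exists_tangent_lift {σ τ ι : Type*} [Fintype σ] [Fintype τ] [Finite ι]
    (G : ι → MvPolynomial (σ ⊕ τ) ℂ) :
    ∃ f : MvPolynomial τ ℂ, f ≠ 0 ∧ ∀ z : σ ⊕ τ → ℂ, eval (z ∘ Sum.inr) f ≠ 0 →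
      (∀ j, eval z (G j) = 0) → ∀ α : τ → ℂ,
      ∃ v : σ ⊕ τ → ℂ, (∀ t, v (Sum.inr t) = α t) ∧ ∀ j, differentialAt z (G j) v = 0 := by
  classical
  choose f hf0 hf using fun t : τ => exists_tangent_lift_of_direction G (Pi.single t 1)
  refine ⟨∏ t, f t, Finset.prod_ne_zero_iff.2 fun t _ => hf0 t, fun z hz hG α => ?_⟩
  rw [map_prod, Finset.prod_ne_zero_iff] at hz
  choose v hv1 hv2 using fun t => hf t z (hz t (Finset.mem_univ t)) hG
  refine ⟨∑ t, α t • v t, fun t => ?_, fun j => ?_⟩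
  · simp [hv1, Pi.single_apply]
  · simp [hv2]

/-- The Jacobian matrix of a family of polynomials at a point. -/
noncomputable def jacobianAt {ι σ : Type*} (F : ι → MvPolynomial σ ℂ) (x : σ → ℂ) :
    Matrix ι σ ℂ :=
  Matrix.of fun k l => eval x (pderiv l (F k))

theorem jacobianAt_mulVec {ι σ : Type*} [Fintype σ] (F : ι → MvPolynomial σ ℂ) (x v : σ → ℂ)
    (k : ι) : (jacobianAt F x).mulVec v k = differentialAt x (F k) v := by
  simp [jacobianAt, Matrix.mulVec, dotProduct, differentialAt_apply]

/-- The equations in `x`, `ν` and `a` which say that `x` is a common zero of `F` and that each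
`ν r` is in the left kernel of the Jacobian of `F` at `x` bordered by the rows of `a`. -/
noncomputable def incidenceEquations {ι κ σ ρ : Type*} [Fintype ι] [Fintype κ]
    (F : ι → MvPolynomial σ ℂ) :
    ι ⊕ ρ × σ → MvPolynomial ((σ ⊕ ρ × (ι ⊕ κ)) ⊕ κ × σ) ℂ
  | Sum.inl k => rename (Sum.inl ∘ Sum.inl) (F k)
  | Sum.inr (r, l) =>
    ∑ k, X (Sum.inl (Sum.inr (r, Sum.inl k))) * rename (Sum.inl ∘ Sum.inl) (pderiv l (F k)) +
      ∑ k, X (Sum.inl (Sum.inr (r, Sum.inr k))) * X (Sum.inr (k, l))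

theorem exists_dotProduct_eq_of_linearIndependent {ρ κ : Type*} [Finite ρ] [Fintype κ]
    {v : ρ → κ → ℂ} (hv : LinearIndependent ℂ v) (y : ρ → ℂ) :
    ∃ α : κ → ℂ, ∀ r, ∑ k, v r k * α k = y r := by
  have := Fintype.ofFinite ρ
  have h : LinearIndependent ℂ (Matrix.of v).row := hv
  have h1 : LinearMap.range (Matrix.of v).mulVecLin = ⊤ := by
    apply Submodule.eq_top_of_finrank_eq
    rw [Module.finrank_fintype_fun_eq_card, ← h.rank_matrix]
    rfl
  obtain ⟨α, hα⟩ := LinearMap.range_eq_top.1 h1 y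
  exact ⟨α, fun r => congrFun hα r⟩

theorem exists_generic_transversality {ι κ σ ρ : Type*} [Fintype ι] [Fintype κ] [Fintype σ]
    [Fintype ρ] (F : ι → MvPolynomial σ ℂ) :
    ∃ f : MvPolynomial (κ × σ) ℂ, f ≠ 0 ∧ ∀ a : Matrix κ σ ℂ, eval (fun q => a q.1 q.2) f ≠ 0 →
      ∀ x : σ → ℂ, (∀ k, eval x (F k) = 0) →
      Function.Surjective (jacobianAt F x).mulVec →
      ∀ ν : ρ → ι ⊕ κ → ℂ, (∀ r, Matrix.vecMul (ν r) (Matrix.fromRows (jacobianAt F x) a) = 0) →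
      LinearIndependent ℂ (fun r => ν r ∘ Sum.inr) →
      ∀ (u : ι → ℂ) (w : ρ → σ → ℂ), ∃ (ξ : σ → ℂ) (μ : ρ → ι ⊕ κ → ℂ),
        (∀ k, differentialAt x (F k) ξ = u k) ∧
        ∀ r l, Matrix.vecMul (μ r) (Matrix.fromRows (jacobianAt F x) a) l +
          ∑ k, ν r (Sum.inl k) * differentialAt x (pderiv l (F k)) ξ = w r l := by
  classical
  obtain ⟨f, hf0, hf⟩ := exists_tangent_lift (incidenceEquations (κ := κ) (ρ := ρ) F)
  refine ⟨f, hf0, fun a ha x hx hJ ν hν hind u w => ?_⟩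
  obtain ⟨ξ₀, hξ₀⟩ := hJ u
  choose α hα using fun l => exists_dotProduct_eq_of_linearIndependent hind fun r =>
    ∑ k, ν r (Sum.inl k) * differentialAt x (pderiv l (F k)) ξ₀ - w r l
  let z : (σ ⊕ ρ × (ι ⊕ κ)) ⊕ κ × σ → ℂ :=
    Sum.elim (Sum.elim x fun q => ν q.1 q.2) fun q => a q.1 q.2
  have hz : z ∘ (Sum.inl ∘ Sum.inl) = x := rfl
  obtain ⟨v, hv1, hv2⟩ := hf z ha (by
    rintro (k | ⟨r, l⟩)
    · simpa [incidenceEquations, eval_rename, hz] using hx k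
    · have := congrFun (hν r) l
      simpa [incidenceEquations, eval_rename, hz, z, Matrix.vecMul, dotProduct, jacobianAt]
        using this) fun q => α q.2 q.1
  refine ⟨ξ₀ + v ∘ (Sum.inl ∘ Sum.inl), fun r k => v (Sum.inl (Sum.inr (r, k))), fun k => ?_,
    fun r l => ?_⟩
  · have h1 := hv2 (Sum.inl k)
    simp only [incidenceEquations, differentialAt_rename, hz] at h1
    rw [map_add, h1, add_zero, ← jacobianAt_mulVec, hξ₀]
  · have h1 := hv2 (Sum.inr (r, l))
    have h2 := hα l r
    simp only [incidenceEquations, map_add, map_sum, differentialAt_mul, differentialAt_X,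
      LinearMap.add_apply, LinearMap.sum_apply, LinearMap.smul_apply, differentialAt_rename,
      eval_rename, hz, eval_X, LinearMap.proj_apply, hv1, smul_eq_mul,
      Finset.sum_add_distrib] at h1
    simp only [z, Sum.elim_inl, Sum.elim_inr] at h1
    simp only [Function.comp_apply] at h2
    simp only [map_add, mul_add, Finset.sum_add_distrib, Matrix.vecMul, dotProduct,
      Fintype.sum_sum_type, Matrix.fromRows_apply_inl, Matrix.fromRows_apply_inr, jacobianAt,
      Matrix.of_apply]
    simp only [mul_comm] at h1 h2 ⊢
    linear_combination h1 - h2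

/-- The differential of the incidence equations in the directions of `x` and `ν`. -/
noncomputable def incidenceDifferential {ι κ σ ρ : Type*} [Fintype ι] [Fintype κ] [Fintype σ]
    (F : ι → MvPolynomial σ ℂ) (a : Matrix κ σ ℂ) (x : σ → ℂ) (ν : ρ → ι ⊕ κ → ℂ) :
    (σ → ℂ) × (ρ → ι ⊕ κ → ℂ) →ₗ[ℂ] (ι → ℂ) × (ρ → σ → ℂ) :=
  LinearMap.prod (LinearMap.pi fun k => differentialAt x (F k) ∘ₗ LinearMap.fst _ _ _)
    (LinearMap.pi fun r => LinearMap.pi fun l =>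
      LinearMap.proj l ∘ₗ (Matrix.fromRows (jacobianAt F x) a).vecMulLinear ∘ₗ
          LinearMap.proj r ∘ₗ LinearMap.snd _ _ _ +
        ∑ k, ν r (Sum.inl k) • (differentialAt x (pderiv l (F k)) ∘ₗ LinearMap.fst _ _ _))

theorem finrank_ker_incidenceDifferential {ι κ σ ρ : Type*} [Fintype ι] [Fintype κ] [Fintype σ]
    [Fintype ρ] (F : ι → MvPolynomial σ ℂ) (a : Matrix κ σ ℂ) (x : σ → ℂ) (ν : ρ → ι ⊕ κ → ℂ)
    (h : Function.Surjective (incidenceDifferential F a x ν)) :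
    Fintype.card ι + Fintype.card ρ * Fintype.card σ +
        Module.finrank ℂ (LinearMap.ker (incidenceDifferential F a x ν)) =
      Fintype.card σ + Fintype.card ρ * (Fintype.card ι + Fintype.card κ) := by
  have h1 := LinearMap.finrank_range_add_finrank_ker (incidenceDifferential F a x ν)
  rw [LinearMap.range_eq_top.2 h, finrank_top] at h1
  simpa [Module.finrank_prod, Module.finrank_pi_fintype] using h1

/-- `a` is transversal with respect to `F` for `ρ`-tuples of left kernel vectors. -/
def IsTransversal {ι κ σ : Type*} (ρ : Type*) [Fintype ι] [Fintype κ] [Fintype σ]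
    (F : ι → MvPolynomial σ ℂ) (a : Matrix κ σ ℂ) : Prop :=
  ∀ x : σ → ℂ, (∀ k, eval x (F k) = 0) → Function.Surjective (jacobianAt F x).mulVec →
    ∀ ν : ρ → ι ⊕ κ → ℂ, (∀ r, Matrix.vecMul (ν r) (Matrix.fromRows (jacobianAt F x) a) = 0) →
    LinearIndependent ℂ (fun r => ν r ∘ Sum.inr) →
    Function.Surjective (incidenceDifferential F a x ν)

theorem exists_forall_isTransversal {ι κ σ : Type*} (ρ : Type*) [Fintype ι] [Fintype κ]
    [Fintype σ] [Fintype ρ] (F : ι → MvPolynomial σ ℂ) :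
    ∃ f : MvPolynomial (κ × σ) ℂ, f ≠ 0 ∧
      ∀ a : Matrix κ σ ℂ, eval (fun q => a q.1 q.2) f ≠ 0 → IsTransversal ρ F a := by
  obtain ⟨f, hf0, hf⟩ := exists_generic_transversality (κ := κ) (ρ := ρ) F
  refine ⟨f, hf0, fun a ha x hx hJ ν hν hind ⟨u, w⟩ => ?_⟩
  obtain ⟨ξ, μ, h1, h2⟩ := hf a ha x hx hJ ν hν hind u w
  refine ⟨(ξ, μ), Prod.ext (funext h1) (funext fun r => funext fun l => ?_)⟩
  simpa [incidenceDifferential] using h2 r l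

theorem mulVec_surjective_vecMul_eq_zero {ι σ : Type*} [Fintype ι] [Fintype σ]
    {J : Matrix ι σ ℂ} (hJ : Function.Surjective J.mulVec) {v : ι → ℂ}
    (hv : Matrix.vecMul v J = 0) : v = 0 := by
  classical
  funext k
  obtain ⟨y, hy⟩ := hJ (Pi.single k 1)
  have h : dotProduct v (J.mulVec y) = 0 := by
    rw [Matrix.dotProduct_mulVec, hv, zero_dotProduct]
  simpa [hy] using h

theorem vecMul_fromRows_eq_zero_of_comp_inr_eq_zero {ι κ σ : Type*} [Fintype ι] [Fintype κ]
    [Fintype σ] {J : Matrix ι σ ℂ} (hJ : Function.Surjective J.mulVec) {a : Matrix κ σ ℂ}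
    {ν : ι ⊕ κ → ℂ} (hν : Matrix.vecMul ν (Matrix.fromRows J a) = 0) (h : ν ∘ Sum.inr = 0) :
    ν = 0 := by
  rw [Matrix.vecMul_fromRows, h, Matrix.zero_vecMul, add_zero] at hν
  have h1 := mulVec_surjective_vecMul_eq_zero hJ hν
  funext k
  exact k.casesOn (congrFun h1) (congrFun h)

theorem linearIndependent_comp_inr {ι κ σ ρ : Type*} [Fintype ι] [Fintype κ]
    [Fintype σ] {J : Matrix ι σ ℂ} (hJ : Function.Surjective J.mulVec) {a : Matrix κ σ ℂ}
    {ν : ρ → LinearMap.ker (Matrix.fromRows J a).vecMulLinear} (hν : LinearIndependent ℂ ν) :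
    LinearIndependent ℂ fun r => (ν r : ι ⊕ κ → ℂ) ∘ Sum.inr := by
  refine hν.map' (LinearMap.funLeft ℂ ℂ Sum.inr ∘ₗ Submodule.subtype _) ?_
  rw [LinearMap.ker_eq_bot']
  exact fun v hv => Subtype.ext (vecMul_fromRows_eq_zero_of_comp_inr_eq_zero hJ v.2 hv)

/-- The directions of the left kernel of the bordered Jacobian are in the kernel of
the differential of the incidence equations. -/
theorem card_mul_finrank_leftKer_le {ι κ σ ρ : Type*} [Fintype ι] [Fintype κ] [Fintype σ]
    [Fintype ρ] (F : ι → MvPolynomial σ ℂ) (a : Matrix κ σ ℂ) (x : σ → ℂ) (ν : ρ → ι ⊕ κ → ℂ) :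
    Fintype.card ρ * Module.finrank ℂ
        (LinearMap.ker (Matrix.fromRows (jacobianAt F x) a).vecMulLinear) ≤
      Module.finrank ℂ (LinearMap.ker (incidenceDifferential F a x ν)) := by
  let N := LinearMap.ker (Matrix.fromRows (jacobianAt F x) a).vecMulLinear
  let j : (ρ → N) →ₗ[ℂ] LinearMap.ker (incidenceDifferential F a x ν) :=
    LinearMap.codRestrict _
      (LinearMap.inr ℂ (σ → ℂ) (ρ → ι ⊕ κ → ℂ) ∘ₗ LinearMap.pi fun r =>
        N.subtype ∘ₗ LinearMap.proj r) fun μ => by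
      refine Prod.ext (funext fun k => ?_) (funext fun r => funext fun l => ?_)
      · simp [incidenceDifferential]
      · simp [incidenceDifferential]
  have hj : Function.Injective j := fun μ μ' h => by
    funext r
    exact Subtype.ext (congrFun (congrArg Prod.snd (congrArg Subtype.val h)) r)
  have := LinearMap.finrank_le_finrank_of_injective hj
  simpa [Module.finrank_pi_fintype] using this

theorem finrank_leftKer_le_one {ι κ σ : Type*} [Fintype ι] [Fintype κ] [Fintype σ]
    {F : ι → MvPolynomial σ ℂ} {a : Matrix κ σ ℂ} (ha : IsTransversal (Fin 2) F a)
    (hcard : Fintype.card ι + 2 * Fintype.card κ < Fintype.card σ + 4)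
    {x : σ → ℂ} (hx : ∀ k, eval x (F k) = 0) (hJ : Function.Surjective (jacobianAt F x).mulVec) :
    Module.finrank ℂ (LinearMap.ker (Matrix.fromRows (jacobianAt F x) a).vecMulLinear) ≤ 1 := by
  by_contra! h
  obtain ⟨ν, hν⟩ := exists_linearIndependent_of_le_finrank (R := ℂ) (n := 2) h
  have h1 := finrank_ker_incidenceDifferential F a x (fun r => (ν r : ι ⊕ κ → ℂ))
    (ha x hx hJ _ (fun r => (ν r).2) (linearIndependent_comp_inr hJ hν))
  have h2 := card_mul_finrank_leftKer_le F a x (fun r => (ν r : ι ⊕ κ → ℂ))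
  simp only [Fintype.card_fin] at h1 h2
  omega

theorem vecMul_eq_zero_of_isTransversal {ι κ σ : Type*} [Fintype ι] [Fintype κ] [Fintype σ]
    {F : ι → MvPolynomial σ ℂ} {a : Matrix κ σ ℂ} (ha : IsTransversal (Fin 1) F a)
    (hcard : Fintype.card ι + Fintype.card κ ≤ Fintype.card σ)
    {x : σ → ℂ} (hx : ∀ k, eval x (F k) = 0) (hJ : Function.Surjective (jacobianAt F x).mulVec)
    {v : κ → ℂ} (hv : Matrix.vecMul v a = 0) : v = 0 := by
  by_contra hne
  have hν : Matrix.vecMul (Sum.elim 0 v) (Matrix.fromRows (jacobianAt F x) a) = 0 := by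
    simp [Matrix.vecMul_fromRows, hv]
  have hs := ha x hx hJ (fun _ => Sum.elim 0 v) (fun _ => hν)
    (LinearIndependent.of_subsingleton 0 hne)
  have hsurj : Function.Surjective (Matrix.fromRows (jacobianAt F x) a).vecMulLinear := by
    intro w
    obtain ⟨⟨ξ, μ⟩, h⟩ := hs (0, fun _ => w)
    refine ⟨μ 0, funext fun l => ?_⟩
    have := congrFun (congrFun (congrArg Prod.snd h) 0) l
    simpa [incidenceDifferential] using this
  have h1 := LinearMap.finrank_range_add_finrank_ker
    (Matrix.fromRows (jacobianAt F x) a).vecMulLinear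
  rw [LinearMap.range_eq_top.2 hsurj, finrank_top] at h1
  have h2 : 0 < Module.finrank ℂ
      (LinearMap.ker (Matrix.fromRows (jacobianAt F x) a).vecMulLinear) := by
    rw [Module.finrank_pos_iff_exists_ne_zero]
    refine ⟨⟨Sum.elim 0 v, hν⟩, fun h => hne ?_⟩
    have := congrArg (fun q => Subtype.val q ∘ Sum.inr) h
    simpa using this
  simp at h1
  omega

/-- Where a matrix of polynomials has a one-dimensional left kernel, the locus of nontrivial left
kernels is cut out by the right number of equations, and there is a polynomial family of left
kernel vectors on this locus. -/
theorem exists_adjugate_kernel {K L σ : Type*} [Fintype K] [Fintype L] [DecidableEq L]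
    (M : Matrix K L (MvPolynomial σ ℂ)) (x₀ : σ → ℂ)
    (hM : Module.finrank ℂ (LinearMap.ker (M.map (eval x₀)).vecMulLinear) = 1) :
    ∃ (ν : K → MvPolynomial σ ℂ) (h : MvPolynomial σ ℂ) (T : Finset L),
      T.card + Fintype.card K = Fintype.card L + 1 ∧ eval x₀ h ≠ 0 ∧
      (∀ l ∉ T, ∑ k, ν k * M k l = 0) ∧
      (∀ x, eval x h ≠ 0 → ∃ k, eval x (ν k) ≠ 0) ∧
      ∀ x, (∃ μ ≠ 0, Matrix.vecMul μ (M.map (eval x)) = 0) →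
        ∀ l, eval x (∑ k, ν k * M k l) = 0 := by
  classical
  set B := M.map (eval x₀) with hB
  have hrank : B.rank + 1 = Fintype.card K := by
    have h1 := LinearMap.finrank_range_add_finrank_ker B.vecMulLinear
    rw [hM, Module.finrank_fintype_fun_eq_card] at h1
    rw [← h1, ← Matrix.rank_transpose, Matrix.rank, Matrix.mulVecLin_transpose]
  obtain ⟨J, c, hc, hspan, hind⟩ := exists_linearIndependent' ℂ B.col
  have : Fintype J := Fintype.ofInjective c hc
  have hJ : Fintype.card J = B.rank := by
    rw [Matrix.rank_eq_finrank_span_cols, ← hspan]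
    exact linearIndependent_iff_card_eq_finrank_span.1 hind
  obtain ⟨w, hw⟩ : ∃ w : K → ℂ, w ∉ Submodule.span ℂ (Set.range (B.col ∘ c)) := by
    by_contra! hall
    have h1 : Submodule.span ℂ (Set.range (B.col ∘ c)) = ⊤ := by
      rw [eq_top_iff]
      exact fun w _ => hall w
    have h2 := linearIndependent_iff_card_eq_finrank_span.1 hind
    rw [Set.finrank, h1, finrank_top, Module.finrank_fintype_fun_eq_card] at h2
    omega
  have e : K ≃ Option J := Fintype.equivOfCardEq (by rw [Fintype.card_option, hJ, hrank])
  let A : Matrix K K (MvPolynomial σ ℂ) :=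
    Matrix.of fun k k' => (e k').elim (C (w k)) fun j => M k (c j)
  let k₀ := e.symm none
  have hsum : ∀ b : K → MvPolynomial σ ℂ,
      ∑ k, A.adjugate k₀ k * b k = (A.updateCol k₀ b).det := fun b => by
    rw [← Matrix.cramer_apply, Matrix.cramer_eq_adjugate_mulVec]
    rfl
  have hAj : ∀ k j, A k (e.symm (some j)) = M k (c j) := fun k j => by simp [A]
  have hAn : ∀ k, A k k₀ = C (w k) := fun k => by simp [A, k₀]
  refine ⟨fun k => A.adjugate k₀ k, A.det, Finset.univ \ Finset.univ.image c, ?_, ?_, ?_, ?_, ?_⟩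
  · rw [Finset.card_sdiff_of_subset (Finset.subset_univ _), Finset.card_image_of_injective _ hc,
      Finset.card_univ, Finset.card_univ]
    have : Fintype.card J ≤ Fintype.card L := Fintype.card_le_of_injective c hc
    omega
  · rw [RingHom.map_det, ← isUnit_iff_ne_zero, ← Matrix.isUnit_iff_isUnit_det,
      ← Matrix.linearIndependent_cols_iff_isUnit]
    have h1 := (linearIndependent_option'.2 ⟨hind, hw⟩).comp e e.injective
    have h2 : ((eval x₀).mapMatrix A).col =
        (fun o : Option J => o.casesOn' w (B.col ∘ c) : Option J → K → ℂ) ∘ e := by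
      funext k' k
      rcases hk : e k' with _ | j
      · simp [A, hk, Matrix.col]
      · simp [A, hk, Matrix.col_apply, hB]
    rw [h2]
    exact h1
  · intro l hl
    rw [Finset.mem_sdiff, not_and, not_not] at hl
    obtain ⟨j, -, rfl⟩ := Finset.mem_image.1 (hl (Finset.mem_univ l))
    rw [hsum]
    refine Matrix.det_zero_of_column_eq (i := k₀) (j := e.symm (some j)) ?_ fun k => ?_
    · simp [k₀]
    · rw [Matrix.updateCol_self, Matrix.updateCol_ne (by simp [k₀]), hAj]
  · intro x hx
    by_contra! hall
    apply hx
    have h1 := hsum fun k => C (w k)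
    rw [show (fun k => C (w k)) = fun k => A k k₀ from funext fun k => (hAn k).symm,
      Matrix.updateCol_eq_self] at h1
    rw [← h1, map_sum]
    exact Finset.sum_eq_zero fun k _ => by rw [map_mul, hall, zero_mul]
  · rintro x ⟨μ, hμ0, hμ⟩ l
    rw [hsum, RingHom.map_det]
    refine Matrix.exists_vecMul_eq_zero_iff.1 ⟨μ, hμ0, funext fun k' => ?_⟩
    have hcol : ∀ l', ∑ k, μ k * eval x (M k l') = 0 := fun l' => congrFun hμ l'
    by_cases hk : k' = k₀
    · subst hk
      simpa [Matrix.vecMul, dotProduct] using hcol l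
    · obtain ⟨o, rfl⟩ := e.symm.surjective k'
      rcases o with _ | j
      · exact absurd rfl hk
      · simpa [Matrix.vecMul, dotProduct, Matrix.updateCol_ne hk, hAj] using hcol (c j)

/-- The translation automorphism of a polynomial ring. -/
noncomputable def translateEquiv {σ : Type*} (c : σ → ℂ) :
    MvPolynomial σ ℂ ≃ₐ[ℂ] MvPolynomial σ ℂ :=
  AlgEquiv.ofAlgHom (aeval fun k => X k + C (c k)) (aeval fun k => X k - C (c k))
    (by ext; simp [← algebraMap_eq]) (by ext; simp [← algebraMap_eq])

theorem comap_translateEquiv_vanishingIdeal {σ : Type*} (c y : σ → ℂ) :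
    (vanishingIdeal ℂ {y} : Ideal (MvPolynomial σ ℂ)).comap
      (translateEquiv c).toRingEquiv = vanishingIdeal ℂ {y + c} := by
  ext f
  rw [Ideal.mem_comap, mem_vanishingIdeal_singleton_iff, mem_vanishingIdeal_singleton_iff]
  have : (aeval y).comp (translateEquiv c).toAlgHom = aeval (y + c) := by
    ext k
    simp [translateEquiv]
  rw [← this]
  rfl

theorem card_le_height_vanishingIdeal_singleton {σ : Type*} [Fintype σ] (x : σ → ℂ) :
    (Fintype.card σ : ℕ∞) ≤ (vanishingIdeal ℂ {x} : Ideal (MvPolynomial σ ℂ)).height := by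
  have h : ringKrullDim (MvPolynomial σ ℂ) ≤
      ((vanishingIdeal ℂ {x} : Ideal (MvPolynomial σ ℂ)).height : WithBot ℕ∞) := by
    rw [ringKrullDim_le_iff_isMaximal_height_le]
    intro m hm
    obtain ⟨y, rfl⟩ := isMaximal_iff_eq_vanishingIdeal_singleton.1 hm
    have := comap_translateEquiv_vanishingIdeal (y - x) x
    rw [add_sub_cancel] at this
    rw [← this, RingEquiv.height_comap]
  rw [MvPolynomial.ringKrullDim_of_isNoetherianRing, ringKrullDim_eq_zero_of_field, zero_add,
    Nat.card_eq_fintype_card] at h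
  exact_mod_cast h

/-- If every prime below the prime `m` and containing `s` contains `J`, passing to the quotient
by `J` drops the height of `m` by at most the cardinality of `s`. -/
theorem Ideal.height_le_height_map_add_card {R : Type*} [CommRing R] [IsNoetherianRing R]
    {m J : Ideal R} [m.IsPrime] (hJ : J ≤ m) (s : Finset R) (hs : (s : Set R) ⊆ m)
    (h : ∀ Q : Ideal R, Q.IsPrime → Q ≤ m → (s : Set R) ⊆ Q → J ≤ Q) :
    m.height ≤ (m.map (Ideal.Quotient.mk J)).height + s.card := by
  classical
  have := Ideal.isPrime_map_quotientMk_of_isPrime hJ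
  obtain ⟨t, ht, hcard⟩ :=
    (m.map (Ideal.Quotient.mk J)).exists_finset_card_eq_height_of_isNoetherianRing
  have hcm : (m.map (Ideal.Quotient.mk J)).comap (Ideal.Quotient.mk J) = m := by
    rw [Ideal.comap_map_mk hJ]
  let t' : Finset R := t.image (Function.surjInv Ideal.Quotient.mk_surjective)
  have ht' : ∀ y ∈ t, ∃ z ∈ t', Ideal.Quotient.mk J z = y := fun y hy =>
    ⟨_, Finset.mem_image_of_mem _ hy, Function.surjInv_eq _ y⟩
  have hmin : m ∈ (Ideal.span ((s ∪ t' : Finset R) : Set R)).minimalPrimes := by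
    refine ⟨⟨inferInstance, Ideal.span_le.2 fun z hz => ?_⟩, fun Q hQ hQm => ?_⟩
    · rcases Finset.mem_union.1 hz with hz | hz
      · exact hs hz
      · obtain ⟨y, hy, rfl⟩ := Finset.mem_image.1 hz
        rw [SetLike.mem_coe, ← hcm, Ideal.mem_comap,
          Function.surjInv_eq Ideal.Quotient.mk_surjective]
        exact ht.1.2 (Ideal.subset_span hy)
    · have hQp := hQ.1
      have hsub := Ideal.span_le.1 hQ.2
      have hJQ : J ≤ Q := h Q hQp hQm fun z hz => hsub (Finset.mem_union_left _ hz)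
      have := Ideal.isPrime_map_quotientMk_of_isPrime hJQ
      have hle := ht.2 (y := Q.map (Ideal.Quotient.mk J)) ⟨this, Ideal.span_le.2 fun y hy => by
        obtain ⟨z, hz, rfl⟩ := ht' y hy
        exact Ideal.mem_map_of_mem _ (hsub (Finset.mem_union_right _ hz))⟩ (Ideal.map_mono hQm)
      have := Ideal.comap_mono (f := Ideal.Quotient.mk J) hle
      rwa [Ideal.comap_map_mk hJ, Ideal.comap_map_mk hJQ] at this
  refine (Ideal.height_le_card_of_mem_minimalPrimes_span_finset hmin).trans ?_
  rw [← hcard, add_comm]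
  exact_mod_cast (Finset.card_union_le s t').trans
    (Nat.add_le_add_left Finset.card_image_le _)

theorem sub_linear_part_mem_sq {σ : Type*} [Fintype σ] (x : σ → ℂ) (f : MvPolynomial σ ℂ) :
    f - C (eval x f) - ∑ k, C (eval x (pderiv k f)) * (X k - C (x k)) ∈
      (vanishingIdeal ℂ {x} : Ideal (MvPolynomial σ ℂ)) *
        (vanishingIdeal ℂ {x} : Ideal (MvPolynomial σ ℂ)) := by
  classical
  have hX : ∀ k, X k - C (x k) ∈ (vanishingIdeal ℂ {x} : Ideal (MvPolynomial σ ℂ)) := fun k => by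
    rw [mem_vanishingIdeal_singleton_iff]
    simp [← algebraMap_eq]
  induction f using MvPolynomial.induction_on with
  | C a => simp
  | add p q hp hq =>
    convert add_mem hp hq using 1
    simp only [map_add, add_mul, Finset.sum_add_distrib]
    ring
  | mul_X p i hp =>
    have h1 : ∑ k, C (eval x (pderiv k p)) * (X k - C (x k)) ∈
        (vanishingIdeal ℂ {x} : Ideal (MvPolynomial σ ℂ)) :=
      Ideal.sum_mem _ fun k _ => Ideal.mul_mem_left _ _ (hX k)
    convert add_mem (Ideal.mul_mem_left _ (X i) hp) (Ideal.mul_mem_mul (hX i) h1) using 1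
    have h2 : ∑ k, C (eval x (pderiv k (p * X i))) * (X k - C (x k)) =
        C (x i) * ∑ k, C (eval x (pderiv k p)) * (X k - C (x k)) +
          C (eval x p) * (X i - C (x i)) := by
      simp only [Derivation.leibniz, pderiv_X, smul_eq_mul, map_add, map_mul, eval_X, add_mul,
        Finset.sum_add_distrib, Finset.mul_sum]
      rw [add_comm]
      congr 1
      · exact Finset.sum_congr rfl fun _ _ => by ring
      · simp [Pi.single_apply, apply_ite]
    rw [h2, map_mul, eval_X, C_mul]
    ring

theorem mem_sq_of_differentialAt_eq_zero {σ : Type*} [Fintype σ] {x : σ → ℂ}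
    {f : MvPolynomial σ ℂ} (h0 : eval x f = 0) (h1 : differentialAt x f = 0) :
    f ∈ (vanishingIdeal ℂ {x} : Ideal (MvPolynomial σ ℂ)) *
        (vanishingIdeal ℂ {x} : Ideal (MvPolynomial σ ℂ)) := by
  classical
  have h := sub_linear_part_mem_sq x f
  have h2 : ∀ k, eval x (pderiv k f) = 0 := fun k => by
    have := LinearMap.congr_fun h1 (Pi.single k 1)
    simpa [differentialAt_apply, Pi.single_apply] using this
  simpa [h0, h2] using h

/-- The Krull dimension of a local ring of a variety is at most the dimension of
the Zariski tangent space. -/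
theorem height_map_mk_le_finrank_dualCoannihilator {σ : Type*} [Fintype σ] (x : σ → ℂ)
    {I J : Ideal (MvPolynomial σ ℂ)} (hIJ : I ≤ J) (hJ : J ≤ vanishingIdeal ℂ {x}) :
    ((vanishingIdeal ℂ {x} : Ideal (MvPolynomial σ ℂ)).map (Ideal.Quotient.mk J)).height ≤
      Module.finrank ℂ
        ((I.restrictScalars ℂ).map (differentialAt x)).dualCoannihilator := by
  classical
  set m : Ideal (MvPolynomial σ ℂ) := vanishingIdeal ℂ {x} with hm
  set D := (I.restrictScalars ℂ).map (differentialAt x) with hD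
  obtain ⟨E, hE⟩ := Submodule.exists_isCompl D
  have hfin : Module.finrank ℂ D.dualCoannihilator = Module.finrank ℂ E := by
    have h1 := Subspace.finrank_add_finrank_dualCoannihilator_eq D
    have h2 := Submodule.finrank_add_eq_of_isCompl hE
    rw [Subspace.dual_finrank_eq] at h2
    omega
  have hmem : ∀ f, f ∈ m ↔ eval x f = 0 := fun f => mem_vanishingIdeal_singleton_iff x f
  let ℓ : Module.Dual ℂ (σ → ℂ) →ₗ[ℂ] MvPolynomial σ ℂ :=
    ∑ k, (LinearMap.toSpanSingleton ℂ _ (X k - C (x k))) ∘ₗ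
      LinearMap.applyₗ (Pi.single k 1 : σ → ℂ)
  have hℓ : ∀ φ, ℓ φ = ∑ k, φ (Pi.single k 1) • (X k - C (x k)) := fun φ => by simp [ℓ]
  have hℓm : ∀ φ, ℓ φ ∈ m := fun φ => by simp [hmem, hℓ]
  have hℓd : ∀ φ, differentialAt x (ℓ φ) = φ := fun φ => by
    refine LinearMap.pi_ext' fun k => LinearMap.ext_ring ?_
    simp [hℓ, differentialAt_X, differentialAt_C, Pi.single_apply]
  let b := Module.finBasis ℂ E
  let s : Finset (MvPolynomial σ ℂ) := Finset.univ.image fun j => ℓ (b j)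
  have hsE : ∀ φ ∈ E, ℓ φ ∈ Ideal.span (s : Set (MvPolynomial σ ℂ)) := fun φ hφ => by
    have h1 : φ = ∑ j, b.repr ⟨φ, hφ⟩ j • (b j : Module.Dual ℂ (σ → ℂ)) := by
      have := congrArg E.subtype (b.sum_repr ⟨φ, hφ⟩)
      rw [map_sum] at this
      exact this.symm
    rw [h1, map_sum]
    refine Ideal.sum_mem _ fun j _ => ?_
    rw [map_smul, smul_eq_C_mul]
    exact Ideal.mul_mem_left _ _ (Ideal.subset_span (by simp [s]))
  have hle : m ≤ (I ⊔ Ideal.span (s : Set (MvPolynomial σ ℂ))) ⊔ m • m := by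
    intro f hf
    have h1 : differentialAt x f ∈ D ⊔ E := by rw [hE.sup_eq_top]; trivial
    obtain ⟨_, ⟨g, hg, rfl⟩, φ, hφ, hsum⟩ := Submodule.mem_sup.1 h1
    have h2 : f - g - ℓ φ ∈ m * m := by
      refine mem_sq_of_differentialAt_eq_zero ?_ ?_
      · rw [← hmem]
        exact sub_mem (sub_mem hf (hJ (hIJ hg))) (hℓm φ)
      · rw [map_sub, map_sub, hℓd, ← hsum]
        abel
    rw [show f = (g + ℓ φ) + (f - g - ℓ φ) by ring]
    exact Submodule.add_mem_sup (Submodule.add_mem_sup hg (hsE φ hφ)) h2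
  obtain ⟨r, hr1, hr2⟩ := Submodule.exists_sub_one_mem_and_smul_le_of_fg_of_le_sup
    (IsNoetherian.noetherian m) le_rfl hle
  have hrm : r ∉ m := fun h => by
    have h1 : (1 : MvPolynomial σ ℂ) ∈ m := by
      have := sub_mem h hr1
      rwa [sub_sub_cancel] at this
    simp [hmem] at h1
  have hmp := Ideal.isPrime_map_quotientMk_of_isPrime hJ
  have hmin : m.map (Ideal.Quotient.mk J) ∈
      (Ideal.span ((s.image (Ideal.Quotient.mk J) : Finset _) :
        Set (MvPolynomial σ ℂ ⧸ J))).minimalPrimes := by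
    refine ⟨⟨hmp, Ideal.span_le.2 ?_⟩, fun Q hQ hQm => ?_⟩
    · intro y hy
      obtain ⟨z, hz, rfl⟩ := Finset.mem_image.1 hy
      obtain ⟨j, -, rfl⟩ := Finset.mem_image.1 hz
      exact Ideal.mem_map_of_mem _ (hℓm _)
    · have hQp := hQ.1
      rw [Ideal.map_le_iff_le_comap]
      intro f hf
      have h1 : r * f ∈ I ⊔ Ideal.span (s : Set (MvPolynomial σ ℂ)) :=
        hr2 (Submodule.smul_mem_pointwise_smul f r m hf)
      have h2 : I ⊔ Ideal.span (s : Set (MvPolynomial σ ℂ)) ≤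
          Q.comap (Ideal.Quotient.mk J) := by
        refine sup_le (fun g hg => ?_) (Ideal.span_le.2 fun z hz => ?_)
        · rw [Ideal.mem_comap, Ideal.Quotient.eq_zero_iff_mem.2 (hIJ hg)]
          exact Q.zero_mem
        · exact hQ.2 (Ideal.subset_span (Finset.mem_image_of_mem _ hz))
      have h3 := h2 h1
      rw [Ideal.mem_comap, map_mul] at h3
      refine (hQp.mem_or_mem h3).resolve_left fun h4 => hrm ?_
      have := hQm h4
      rwa [← Ideal.mem_comap, Ideal.comap_map_mk hJ] at this
  refine (Ideal.height_le_card_of_mem_minimalPrimes_span_finset hmin).trans ?_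
  rw [hfin]
  have := (Finset.card_image_le (s := s) (f := Ideal.Quotient.mk J)).trans
    (Finset.card_image_le (s := Finset.univ) (f := fun j => ℓ (b j)))
  rw [Finset.card_univ, Fintype.card_fin] at this
  exact_mod_cast this

theorem tangentAt_eq_dualCoannihilator {σ : Type} [Fintype σ] [DecidableEq σ]
    (T : Set (σ → ℂ)) (x : σ → ℂ) :
    tangentAt T x =
      (((vanishingIdeal ℂ T).restrictScalars ℂ).map (differentialAt x)).dualCoannihilator := by
  ext v
  rw [tangentAt, Submodule.mem_dualCoannihilator]
  simp only [Submodule.mem_iInf, LinearMap.mem_ker]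
  constructor
  · rintro h _ ⟨f, hf, rfl⟩
    exact h f hf
  · exact fun h f hf => h _ ⟨f, hf, rfl⟩

theorem le_vanishingIdeal_singleton_iff {σ : Type*} {x : σ → ℂ} {I : Ideal (MvPolynomial σ ℂ)} :
    I ≤ vanishingIdeal ℂ {x} ↔ x ∈ zeroLocus ℂ I :=
  ⟨fun h f hf => (mem_vanishingIdeal_singleton_iff x f).1 (h hf),
    fun h f hf => (mem_vanishingIdeal_singleton_iff x f).2 (h f hf)⟩

theorem exists_mem_zeroLocus_eval_ne_zero {σ : Type*} [Finite σ] {P : Ideal (MvPolynomial σ ℂ)}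
    [P.IsPrime] {u : MvPolynomial σ ℂ} (hu : u ∉ P) : ∃ x ∈ zeroLocus ℂ P, eval x u ≠ 0 := by
  by_contra! h
  rw [← IsPrime.vanishingIdeal_zeroLocus (K := ℂ) P] at hu
  exact hu h

theorem card_le_height_map_mk_add_card {σ : Type} [Fintype σ] {W : Set (σ → ℂ)} {x₀ : σ → ℂ}
    {J : Ideal (MvPolynomial σ ℂ)} (hJ : J ≤ vanishingIdeal ℂ {x₀}) (hx₀ : x₀ ∈ W)
    {u : MvPolynomial σ ℂ} (hu : eval x₀ u ≠ 0) (huJ : ∀ f ∈ J, u * f ∈ vanishingIdeal ℂ W)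
    {s : Finset (MvPolynomial σ ℂ)} {h : MvPolynomial σ ℂ} (hh : eval x₀ h ≠ 0)
    (hsW : ∀ g ∈ s, ∀ x ∈ W, eval x g = 0)
    (hWs : ∀ x, eval x h ≠ 0 → (∀ g ∈ s, eval x g = 0) → x ∈ W) :
    (Fintype.card σ : ℕ∞) ≤ ((vanishingIdeal ℂ {x₀} : Ideal (MvPolynomial σ ℂ)).map
      (Ideal.Quotient.mk J)).height + s.card := by
  have hmem : ∀ f, f ∈ (vanishingIdeal ℂ {x₀} : Ideal (MvPolynomial σ ℂ)) ↔ eval x₀ f = 0 :=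
    fun f => mem_vanishingIdeal_singleton_iff x₀ f
  refine (card_le_height_vanishingIdeal_singleton x₀).trans
    (Ideal.height_le_height_map_add_card hJ s
      (fun g hg => (hmem g).2 (hsW g hg x₀ hx₀)) fun Q hQ hQm hsQ f hf => ?_)
  have h1 : h * (u * f) ∈ Q := by
    rw [← IsPrime.vanishingIdeal_zeroLocus (K := ℂ) Q]
    intro x hx
    rw [map_mul]
    by_cases hx0 : eval x h = 0
    · rw [aeval_eq_eval]
      exact mul_eq_zero_of_left hx0 _
    · rw [huJ f hf x (hWs x hx0 fun g hg => hx g (hsQ hg)), mul_zero]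
  have h2 := (hQ.mem_or_mem h1).resolve_left fun h3 => hh ((hmem h).1 (hQm h3))
  exact (hQ.mem_or_mem h2).resolve_left fun h3 => hu ((hmem u).1 (hQm h3))

/-- The Jacobian criterion for a closed set which is locally cut out by `c` equations and
whose tangent spaces have dimension at most `|σ| - c`. -/
theorem isPureDim_and_finrank_tangentAt {σ : Type} [Fintype σ] [DecidableEq σ]
    {W : Set (σ → ℂ)} {e c : ℕ} (hec : e + c = Fintype.card σ) (hW : zcl W ⊆ W)
    (hloc : ∀ x₀ ∈ W, ∃ (s : Finset (MvPolynomial σ ℂ)) (h : MvPolynomial σ ℂ), s.card ≤ c ∧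
      eval x₀ h ≠ 0 ∧ (∀ g ∈ s, ∀ x ∈ W, eval x g = 0) ∧
      ∀ x, eval x h ≠ 0 → (∀ g ∈ s, eval x g = 0) → x ∈ W)
    (htan : ∀ x₀ ∈ W, Module.finrank ℂ (tangentAt W x₀) ≤ e) :
    IsPureDim W e ∧ ∀ x₀ ∈ W, Module.finrank ℂ (tangentAt W x₀) = e := by
  have hupper : ∀ x₀ ∈ W, ∀ J : Ideal (MvPolynomial σ ℂ), vanishingIdeal ℂ W ≤ J →
      J ≤ vanishingIdeal ℂ {x₀} → ((vanishingIdeal ℂ {x₀} : Ideal (MvPolynomial σ ℂ)).map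
        (Ideal.Quotient.mk J)).height ≤ Module.finrank ℂ (tangentAt W x₀) := by
    intro x₀ _ J hIJ hJ
    rw [tangentAt_eq_dualCoannihilator]
    exact height_map_mk_le_finrank_dualCoannihilator x₀ hIJ hJ
  have hlower : ∀ x₀ ∈ W, ∀ J : Ideal (MvPolynomial σ ℂ), J ≤ vanishingIdeal ℂ {x₀} →
      ∀ u, eval x₀ u ≠ 0 → (∀ f ∈ J, u * f ∈ vanishingIdeal ℂ W) →
      (e : ℕ∞) ≤ ((vanishingIdeal ℂ {x₀} : Ideal (MvPolynomial σ ℂ)).map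
        (Ideal.Quotient.mk J)).height := by
    intro x₀ hx₀ J hJ u hu huJ
    obtain ⟨s, h, hs, hh, hsW, hWs⟩ := hloc x₀ hx₀
    have h1 := card_le_height_map_mk_add_card hJ hx₀ hu huJ hh hsW hWs
    have h2 : ((e + c : ℕ) : ℕ∞) ≤ ((vanishingIdeal ℂ {x₀} : Ideal (MvPolynomial σ ℂ)).map
        (Ideal.Quotient.mk J)).height + (c : ℕ) := by
      rw [hec]
      exact h1.trans (add_le_add_right (by exact_mod_cast hs) _)
    rw [Nat.cast_add] at h2
    exact (ENat.add_le_add_iff_right (ENat.natCast_ne_top c)).1 h2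
  refine ⟨fun P hP => Eq.trans (b := ((e : ℕ∞) : WithBot ℕ∞)) (le_antisymm ?_ ?_) rfl, fun x₀ hx₀ => le_antisymm (htan x₀ hx₀) ?_⟩
  · rw [ringKrullDim_le_iff_isMaximal_height_le]
    intro M hM
    have hcM := Ideal.comap_isMaximal_of_surjective (Ideal.Quotient.mk P)
      Ideal.Quotient.mk_surjective (K := M)
    obtain ⟨x₀, hx₀⟩ := isMaximal_iff_eq_vanishingIdeal_singleton.1 hcM
    have hPm : P ≤ vanishingIdeal ℂ {x₀} := by
      rw [← hx₀]
      intro f hf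
      rw [Ideal.mem_comap, Ideal.Quotient.eq_zero_iff_mem.2 hf]
      exact M.zero_mem
    have hxW : x₀ ∈ W := hW (le_vanishingIdeal_singleton_iff.1 (hP.1.2.trans hPm))
    have h1 := hupper x₀ hxW P hP.1.2 hPm
    rw [← hx₀, Ideal.map_comap_of_surjective _ Ideal.Quotient.mk_surjective] at h1
    exact_mod_cast h1.trans (by exact_mod_cast htan x₀ hxW)
  · have hPp := hP.1.1
    obtain ⟨u, huP, hu⟩ := Ideal.exists_notMem_forall_mul_mem_of_mem_minimalPrimes
      (isRadical_vanishingIdeal W) hP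
    obtain ⟨x₀, hx₀, hux⟩ := exists_mem_zeroLocus_eval_ne_zero huP
    have hPm := le_vanishingIdeal_singleton_iff.2 hx₀
    have hxW : x₀ ∈ W := hW (le_vanishingIdeal_singleton_iff.1 (hP.1.2.trans hPm))
    have h1 := hlower x₀ hxW P hPm u hux hu
    have := Ideal.isPrime_map_quotientMk_of_isPrime hPm
    refine le_trans ?_ (Ideal.height_le_ringKrullDim_of_ne_top (this.ne_top))
    exact_mod_cast h1
  · have hIm : vanishingIdeal ℂ W ≤ vanishingIdeal ℂ {x₀} := by
      rintro f hf _ rfl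
      exact hf _ hx₀
    have h1 := (hlower x₀ hx₀ _ hIm 1 (by simp) (by simp)).trans (hupper x₀ hx₀ _ le_rfl hIm)
    exact_mod_cast h1

/-- The common zeros of `F` at which the Jacobian bordered by `a` has a nontrivial left kernel. -/
def degeneracyLocus {ι κ σ : Type*} [Fintype ι] [Fintype κ] (F : ι → MvPolynomial σ ℂ)
    (a : Matrix κ σ ℂ) : Set (σ → ℂ) :=
  {x | (∀ k, eval x (F k) = 0) ∧
    ∃ ν ≠ 0, Matrix.vecMul ν (Matrix.fromRows (jacobianAt F x) a) = 0}

/-- The Jacobian matrix bordered by a constant matrix, as a matrix of polynomials. -/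
noncomputable def borderedJacobian {ι κ σ : Type*} (F : ι → MvPolynomial σ ℂ)
    (a : Matrix κ σ ℂ) : Matrix (ι ⊕ κ) σ (MvPolynomial σ ℂ) :=
  Matrix.fromRows (Matrix.of fun k l => pderiv l (F k)) (a.map C)

theorem borderedJacobian_map_eval {ι κ σ : Type*} (F : ι → MvPolynomial σ ℂ)
    (a : Matrix κ σ ℂ) (x : σ → ℂ) :
    (borderedJacobian F a).map (eval x) = Matrix.fromRows (jacobianAt F x) a := by
  ext (k | k) l <;> simp [borderedJacobian, jacobianAt]

theorem mulVec_surjective_of_rank_eq {ι σ : Type*} [Fintype ι] [Fintype σ] {A : Matrix ι σ ℂ}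
    (h : A.rank = Fintype.card ι) : Function.Surjective A.mulVec := by
  have h1 : LinearMap.range A.mulVecLin = ⊤ := by
    apply Submodule.eq_top_of_finrank_eq
    rw [Module.finrank_fintype_fun_eq_card, ← h]
    rfl
  exact LinearMap.range_eq_top.1 h1

theorem zcl_degeneracyLocus_subset {ι κ σ : Type} [Fintype ι] [Fintype κ] [Fintype σ]
    (F : ι → MvPolynomial σ ℂ) (a : Matrix κ σ ℂ) :
    zcl (degeneracyLocus F a) ⊆ degeneracyLocus F a := by
  classical
  intro x hx
  refine ⟨fun k => hx (F k) fun y hy => hy.1 k, ?_⟩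
  by_contra! hne
  have hsurj : Function.Surjective (Matrix.fromRows (jacobianAt F x) a).mulVec := by
    have hinj : Function.Injective (Matrix.fromRows (jacobianAt F x) a).vecMulLinear := by
      rw [← LinearMap.ker_eq_bot, LinearMap.ker_eq_bot']
      exact fun ν hν => by_contra fun h => hne ν h hν
    have h1 : LinearIndependent ℂ (Matrix.fromRows (jacobianAt F x) a).row :=
      Matrix.vecMul_injective_iff.1 hinj
    exact mulVec_surjective_of_rank_eq h1.rank_matrix
  obtain ⟨D, hD⟩ := Matrix.mulVec_surjective_iff_exists_right_inverse.1 hsurj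
  let D' : Matrix σ (ι ⊕ κ) (MvPolynomial σ ℂ) := Matrix.map D C
  have heval : ∀ y, eval y (Matrix.det (borderedJacobian F a * D')) =
      (Matrix.fromRows (jacobianAt F y) a * D).det := fun y => by
    rw [RingHom.map_det, RingHom.mapMatrix_apply, Matrix.map_mul, borderedJacobian_map_eval]
    congr 2
    ext
    simp [D']
  have h1 : eval x (Matrix.det (borderedJacobian F a * D')) = 0 := hx _ fun y hy => by
    obtain ⟨-, ν, hν0, hν⟩ := hy
    rw [aeval_eq_eval]
    refine (heval y).trans (Matrix.exists_vecMul_eq_zero_iff.1 ⟨ν, hν0, ?_⟩)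
    rw [← Matrix.vecMul_vecMul, hν, Matrix.zero_vecMul]
  rw [heval, hD, Matrix.det_one] at h1
  exact one_ne_zero h1

theorem differentialAt_mem_tangentAt {σ : Type} [Fintype σ] [DecidableEq σ] {T : Set (σ → ℂ)}
    {x ξ : σ → ℂ} (hξ : ξ ∈ tangentAt T x) {f : MvPolynomial σ ℂ}
    (hf : f ∈ vanishingIdeal ℂ T) : differentialAt x f ξ = 0 := by
  rw [tangentAt, Submodule.mem_iInf] at hξ
  exact (Submodule.mem_iInf _).1 (hξ f) hf

theorem incidenceDifferential_snd_apply {ρ ι κ σ : Type*} [Fintype ι] [Fintype κ] [Fintype σ]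
    (F : ι → MvPolynomial σ ℂ) (a : Matrix κ σ ℂ) (x : σ → ℂ) (ν : ρ → ι ⊕ κ → ℂ)
    (q : (σ → ℂ) × (ρ → ι ⊕ κ → ℂ)) (r : ρ) (l : σ) :
    (incidenceDifferential F a x ν q).2 r l =
      Matrix.vecMul (q.2 r) (Matrix.fromRows (jacobianAt F x) a) l +
        ∑ k, ν r (Sum.inl k) * differentialAt x (pderiv l (F k)) q.1 := by
  simp [incidenceDifferential]

section DegeneracyLocus

variable {ι κ σ : Type} [Fintype ι] [Fintype κ] [Fintype σ] [DecidableEq σ]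
  {F : ι → MvPolynomial σ ℂ} {a : Matrix κ σ ℂ}

theorem finrank_tangentAt_degeneracyLocus_add_le {x : σ → ℂ} (ν : ι ⊕ κ → MvPolynomial σ ℂ)
    (hν : ∀ l, ∑ k, ν k * borderedJacobian F a k l ∈ vanishingIdeal ℂ (degeneracyLocus F a)) :
    Module.finrank ℂ (tangentAt (degeneracyLocus F a) x) + Module.finrank ℂ
        (LinearMap.ker (Matrix.fromRows (jacobianAt F x) a).vecMulLinear) ≤
      Module.finrank ℂ (LinearMap.ker (incidenceDifferential F a x
        fun _ : Fin 1 => fun k => eval x (ν k))) := by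
  set T := tangentAt (degeneracyLocus F a) x
  set N := LinearMap.ker (Matrix.fromRows (jacobianAt F x) a).vecMulLinear
  let j₀ : (T × N) →ₗ[ℂ] (σ → ℂ) × (Fin 1 → ι ⊕ κ → ℂ) :=
    LinearMap.prod (T.subtype ∘ₗ LinearMap.fst ℂ T N)
      (LinearMap.pi fun _ : Fin 1 =>
        (LinearMap.pi fun k => differentialAt x (ν k)) ∘ₗ T.subtype ∘ₗ LinearMap.fst ℂ T N +
          N.subtype ∘ₗ LinearMap.snd ℂ T N)
  have hj₀ : ∀ q : T × N, j₀ q = ((q.1 : σ → ℂ), fun (_ : Fin 1) (k : ι ⊕ κ) =>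
    differentialAt x (ν k) (q.1 : σ → ℂ) + (q.2 : ι ⊕ κ → ℂ) k) := fun q => rfl
  let j : (T × N) →ₗ[ℂ] LinearMap.ker (incidenceDifferential F a x
      fun _ : Fin 1 => fun k => eval x (ν k)) :=
    LinearMap.codRestrict _ j₀ fun q => by
      refine Prod.ext (funext fun k => ?_) (funext fun r => funext fun l => ?_)
      · exact differentialAt_mem_tangentAt q.1.2 fun y hy => hy.1 k
      · have h1 := differentialAt_mem_tangentAt q.1.2 (hν l)
        have h2 : ∑ k, (q.2 : ι ⊕ κ → ℂ) k * Matrix.fromRows (jacobianAt F x) a k l = 0 :=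
          congrFun q.2.2 l
        simp only [borderedJacobian, Fintype.sum_sum_type, Matrix.fromRows_apply_inl,
          Matrix.fromRows_apply_inr, Matrix.of_apply, Matrix.map_apply, map_add, map_sum,
          differentialAt_mul, differentialAt_C, eval_C, LinearMap.sum_apply, LinearMap.add_apply,
          LinearMap.smul_apply, LinearMap.zero_apply, smul_eq_mul, Finset.sum_add_distrib,
          mul_zero, Finset.sum_const_zero, zero_add] at h1
        simp only [Fintype.sum_sum_type, Matrix.fromRows_apply_inl, Matrix.fromRows_apply_inr,
          jacobianAt, Matrix.of_apply] at h2
        rw [incidenceDifferential_snd_apply, hj₀]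
        simp only [Matrix.vecMul, dotProduct, Fintype.sum_sum_type,
          Matrix.fromRows_apply_inl, Matrix.fromRows_apply_inr, jacobianAt, Matrix.of_apply,
          add_mul, Finset.sum_add_distrib, Prod.snd_zero, Pi.zero_apply]
        simp only [mul_comm] at h1 h2 ⊢
        linear_combination h1 + h2
  have hj : Function.Injective j := by
    rintro ⟨ξ, μ⟩ ⟨ξ', μ'⟩ h
    have h1 : j₀ (ξ, μ) = j₀ (ξ', μ') := congrArg Subtype.val h
    rw [hj₀, hj₀, Prod.mk.injEq] at h1
    obtain rfl : ξ = ξ' := Subtype.ext h1.1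
    refine Prod.ext rfl (Subtype.ext (funext fun k => ?_))
    exact add_left_cancel (congrFun (congrFun h1.2 0) k)
  have := LinearMap.finrank_le_finrank_of_injective hj
  rwa [Module.finrank_prod] at this

theorem degeneracyLocus_isPureDim {e : ℕ} (he : e + 1 = Fintype.card κ)
    (heσ : e ≤ Fintype.card σ)
    (ha : IsTransversal (Fin 1) F a)
    (hJ : ∀ x, (∀ k, eval x (F k) = 0) → Function.Surjective (jacobianAt F x).mulVec)
    (hN : ∀ x, (∀ k, eval x (F k) = 0) → Module.finrank ℂ
      (LinearMap.ker (Matrix.fromRows (jacobianAt F x) a).vecMulLinear) ≤ 1) :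
    IsPureDim (degeneracyLocus F a) e ∧
      ∀ x ∈ degeneracyLocus F a, Module.finrank ℂ (tangentAt (degeneracyLocus F a) x) = e := by
  classical
  have hN1 : ∀ x ∈ degeneracyLocus F a, Module.finrank ℂ
      (LinearMap.ker (Matrix.fromRows (jacobianAt F x) a).vecMulLinear) = 1 := by
    rintro x ⟨hx, μ, hμ0, hμ⟩
    refine le_antisymm (hN x hx) ?_
    rw [Nat.one_le_iff_ne_zero, ← Nat.pos_iff_ne_zero, Module.finrank_pos_iff_exists_ne_zero]
    exact ⟨⟨μ, hμ⟩, fun h => hμ0 (congrArg Subtype.val h)⟩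
  have hker : ∀ x ∈ degeneracyLocus F a, _ := fun x hx =>
    exists_adjugate_kernel (borderedJacobian F a) x
      (by rw [borderedJacobian_map_eval]; exact hN1 x hx)
  simp only [borderedJacobian_map_eval] at hker
  refine isPureDim_and_finrank_tangentAt (c := Fintype.card σ - e) (by omega)
    (zcl_degeneracyLocus_subset F a) (fun x₀ hx₀ => ?_) fun x₀ hx₀ => ?_
  · obtain ⟨ν, h, T, hT, hh, hTν, hν, hg⟩ := hker x₀ hx₀
    refine ⟨Finset.univ.image F ∪ T.image fun l => ∑ k, ν k * borderedJacobian F a k l, h, ?_, hh,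
      fun g hgs x hx => ?_, fun x hx hzero => ⟨fun k => hzero _ ?_, fun k => eval x (ν k), ?_, ?_⟩⟩
    · refine (Finset.card_union_le _ _).trans ((Nat.add_le_add Finset.card_image_le
        Finset.card_image_le).trans ?_)
      rw [Finset.card_univ]
      rw [Fintype.card_sum] at hT
      omega
    · rcases Finset.mem_union.1 hgs with hgs | hgs
      · obtain ⟨k, -, rfl⟩ := Finset.mem_image.1 hgs
        exact hx.1 k
      · obtain ⟨l, -, rfl⟩ := Finset.mem_image.1 hgs
        exact hg x hx.2 l
    · exact Finset.mem_union_left _ (Finset.mem_image_of_mem _ (Finset.mem_univ k))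
    · obtain ⟨k, hk⟩ := hν x hx
      exact fun h0 => hk (congrFun h0 k)
    · funext l
      have h1 : eval x (∑ k, ν k * borderedJacobian F a k l) = 0 := by
        by_cases hl : l ∈ T
        · exact hzero _ (Finset.mem_union_right _ (Finset.mem_image_of_mem _ hl))
        · rw [hTν l hl, map_zero]
      rw [map_sum] at h1
      rw [← borderedJacobian_map_eval]
      simpa [Matrix.vecMul, dotProduct] using h1
  · obtain ⟨ν, h, T, hT, hh, hTν, hν, hg⟩ := hker x₀ hx₀
    have h1 := finrank_tangentAt_degeneracyLocus_add_le (x := x₀) ν fun l x hx => hg x hx.2 l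
    have hν₀ : Matrix.vecMul (fun k => eval x₀ (ν k))
        (Matrix.fromRows (jacobianAt F x₀) a) = 0 := by
      funext l
      have h2 := hg x₀ hx₀.2 l
      rw [map_sum] at h2
      rw [← borderedJacobian_map_eval]
      simpa [Matrix.vecMul, dotProduct] using h2
    have hs := ha x₀ hx₀.1 (hJ x₀ hx₀.1) (fun _ => fun k => eval x₀ (ν k)) (fun _ => hν₀)
      (LinearIndependent.of_subsingleton 0 fun h3 => by
        obtain ⟨k, hk⟩ := hν x₀ hh
        exact hk (congrFun (vecMul_fromRows_eq_zero_of_comp_inr_eq_zero (hJ x₀ hx₀.1) hν₀ h3) k))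
    have h2 := finrank_ker_incidenceDifferential F a x₀ _ hs
    rw [hN1 x₀ hx₀] at h1
    rw [Fintype.card_fin] at h2
    omega

end DegeneracyLocus

theorem rank_add_finrank_ker_vecMulLinear {ι σ : Type*} [Fintype ι] [Fintype σ]
    (A : Matrix ι σ ℂ) :
    A.rank + Module.finrank ℂ (LinearMap.ker A.vecMulLinear) = Fintype.card ι := by
  rw [← Matrix.rank_transpose, Matrix.rank, Matrix.mulVecLin_transpose,
    LinearMap.finrank_range_add_finrank_ker, Module.finrank_fintype_fun_eq_card]

theorem rank_add_finrank_ker_mulVecLin {ι σ : Type*} [Fintype ι] [Fintype σ]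
    (A : Matrix ι σ ℂ) :
    A.rank + Module.finrank ℂ (LinearMap.ker A.mulVecLin) = Fintype.card σ := by
  rw [Matrix.rank, LinearMap.finrank_range_add_finrank_ker, Module.finrank_fintype_fun_eq_card]

theorem mem_degeneracyLocus_iff {ι κ σ : Type*} [Fintype ι] [Fintype κ] [Fintype σ]
    {F : ι → MvPolynomial σ ℂ} {a : Matrix κ σ ℂ} {x : σ → ℂ} :
    x ∈ degeneracyLocus F a ↔ (∀ k, eval x (F k) = 0) ∧
      (Matrix.fromRows (jacobianAt F x) a).rank < Fintype.card ι + Fintype.card κ := by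
  refine and_congr_right fun _ => ?_
  have h := rank_add_finrank_ker_vecMulLinear (Matrix.fromRows (jacobianAt F x) a)
  rw [Fintype.card_sum] at h
  rw [← h, Nat.lt_add_right_iff_pos, Module.finrank_pos_iff_exists_ne_zero]
  constructor
  · rintro ⟨ν, h0, hν⟩
    exact ⟨⟨ν, hν⟩, fun h => h0 (congrArg Subtype.val h)⟩
  · rintro ⟨ν, h0⟩
    exact ⟨ν, fun h => h0 (Subtype.ext h), ν.2⟩

theorem tangentAt_eq_ker_jacobianAt {ι σ : Type} [Fintype σ] [DecidableEq σ]
    {F : ι → MvPolynomial σ ℂ} {T : Set (σ → ℂ)}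
    (hT : vanishingIdeal ℂ T = Ideal.span (Set.range F)) {x : σ → ℂ} (hx : x ∈ T) :
    tangentAt T x = LinearMap.ker (jacobianAt F x).mulVecLin := by
  have hmem : ∀ k, F k ∈ vanishingIdeal ℂ T := fun k =>
    hT.symm ▸ Ideal.subset_span ⟨k, rfl⟩
  refine le_antisymm (fun v hv => funext fun k => ?_) fun v hv => ?_
  · exact (jacobianAt_mulVec F x v k).trans (differentialAt_mem_tangentAt hv (hmem k))
  · simp only [tangentAt, Submodule.mem_iInf]
    intro f hf
    change differentialAt x f v = 0
    have hf' := hf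
    rw [hT] at hf'
    induction hf' using Submodule.span_induction with
    | mem g hg =>
      obtain ⟨k, rfl⟩ := hg
      exact (jacobianAt_mulVec F x v k).symm.trans (congrFun hv k)
    | zero => simp
    | add g h hg hh ihg ihh =>
      rw [map_add, LinearMap.add_apply, ihg (hT.symm ▸ hg), ihh (hT.symm ▸ hh), add_zero]
    | smul c g hg ih =>
      have hg' : g ∈ vanishingIdeal ℂ T := hT.symm ▸ hg
      have h0 : eval x g = 0 := hg' x hx
      rw [smul_eq_mul, differentialAt_mul, LinearMap.add_apply, LinearMap.smul_apply,
        LinearMap.smul_apply, ih hg', h0, smul_zero, zero_smul, add_zero]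

theorem ker_mulVecLin_fromRows {ι κ σ : Type*} [Fintype σ] (A : Matrix ι σ ℂ)
    (B : Matrix κ σ ℂ) : LinearMap.ker (Matrix.fromRows A B).mulVecLin =
      LinearMap.ker A.mulVecLin ⊓ LinearMap.ker B.mulVecLin := by
  ext v
  simp only [Submodule.mem_inf, LinearMap.mem_ker, Matrix.mulVecLin_apply,
    Matrix.fromRows_mulVec, funext_iff, Sum.forall, Sum.elim_inl, Sum.elim_inr, Pi.zero_apply]

theorem jacC_eq_jacobianAt {n p : ℕ} (F : Fin p → MvPolynomial (Fin n) ℚ) (x : Fin n → ℂ) :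
    jacC F x = jacobianAt (fun k => map (algebraMap ℚ ℂ) (F k)) x := by
  ext k l
  simp [jacC, jacobianAt, pderiv_map, eval_map, aeval_def]

theorem mem_zeroSetC_iff {n p : ℕ} {F : Fin p → MvPolynomial (Fin n) ℚ} {x : Fin n → ℂ} :
    x ∈ zeroSetC F ↔ ∀ k, eval x (map (algebraMap ℚ ℂ) (F k)) = 0 := by
  simp [zeroSetC, eval_map, aeval_def]

/-- Section 3.2, alternative proof of Proposition 1. Suppose `S` is
smooth and `1 ≤ i ≤ n-p` with `2i+2 > n-p`. Then there is a nonempty Zariski open set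
`U_i` of full-rank `(n-p-i+1) × n` matrices such that for every `a ∈ U_i`:
`Σ^{(j)}(π_a) = ∅` for all `i < j ≤ n-p`;
`W_{K(a)}(S) ∩ S_reg = Σ^{(i)}(π_a)`; and `W_{K(a)}(S) ∩ S_reg` is empty or a smooth
subvariety of `S` of codimension `i` (pure dimension `n-p-i`, smooth at each point). -/
theorem statement14 {n p i : ℕ} (hp1 : 1 ≤ p) (hpn : p ≤ n)
    (hi1 : 1 ≤ i) (hi2 : i ≤ n - p) (hcodim : 2 * i + 2 > n - p)
    (F : Fin p → MvPolynomial (Fin n) ℚ)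
    (hreg : IsRegSeq (List.ofFn F))
    (hrad : idealOfDef F)
    (hSne : (zeroSetC F).Nonempty)
    (hSdim : IsPureDim (zeroSetC F) (n - p))
    (hsmooth : SregC F = zeroSetC F) :
    ∃ U : Set (Matrix (Fin (n - p - i + 1)) (Fin n) ℂ),
      U.Nonempty ∧ ZOpenMat U ∧
      ∀ a ∈ U,
        a.rank = n - p - i + 1 ∧
        (∀ j, i < j → j ≤ n - p → SigmaStr F a j = ∅) ∧
        (Wclassic F a (n - i) ∩ SregC F = SigmaStr F a i) ∧
        (Wclassic F a (n - i) ∩ SregC F = ∅ ∨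
          (IsPureDim (Wclassic F a (n - i) ∩ SregC F) (n - p - i) ∧
           ∀ x ∈ Wclassic F a (n - i) ∩ SregC F,
             Module.finrank ℂ
               ↥(tangentAt (Wclassic F a (n - i) ∩ SregC F) x) = n - p - i)) := by
  set G : Fin p → MvPolynomial (Fin n) ℂ := fun k => map (algebraMap ℚ ℂ) (F k)
  obtain ⟨f₁, hf₁, h₁⟩ := exists_forall_isTransversal (κ := Fin (n - p - i + 1)) (Fin 1) G
  obtain ⟨f₂, hf₂, h₂⟩ := exists_forall_isTransversal (κ := Fin (n - p - i + 1)) (Fin 2) G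
  have hJ : ∀ x, (∀ k, eval x (G k) = 0) → Function.Surjective (jacobianAt G x).mulVec := by
    intro x hx
    have h : x ∈ SregC F := hsmooth ▸ mem_zeroSetC_iff.2 hx
    exact mulVec_surjective_of_rank_eq (by rw [← jacC_eq_jacobianAt, h.2, Fintype.card_fin])
  refine ⟨{a | ∃ f ∈ Ideal.span {f₁ * f₂}, eval (fun q => a q.1 q.2) f ≠ 0}, ?_,
    ⟨_, rfl⟩, ?_⟩
  · by_contra! h
    refine mul_ne_zero hf₁ hf₂ (MvPolynomial.funext fun z => ?_)
    by_contra hz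
    refine (Set.eq_empty_iff_forall_notMem.1 h) (Matrix.of fun k l => z (k, l))
      ⟨_, Ideal.mem_span_singleton_self _, ?_⟩
    rwa [map_zero] at hz
  rintro a ⟨f, hf, hfa⟩
  obtain ⟨g, rfl⟩ := Ideal.mem_span_singleton.1 hf
  rw [map_mul, map_mul] at hfa
  have ha₁ := h₁ a (left_ne_zero_of_mul (left_ne_zero_of_mul hfa))
  have ha₂ := h₂ a (right_ne_zero_of_mul (left_ne_zero_of_mul hfa))
  have hN : ∀ x, (∀ k, eval x (G k) = 0) → Module.finrank ℂ
      (LinearMap.ker (Matrix.fromRows (jacobianAt G x) a).vecMulLinear) ≤ 1 := fun x hx =>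
    finrank_leftKer_le_one ha₂ (by simp only [Fintype.card_fin]; omega) hx (hJ x hx)
  have hfin : ∀ x ∈ zeroSetC F, Module.finrank ℂ
      ↥(tangentAt (zeroSetC F) x ⊓ LinearMap.ker (Matrix.mulVecLin a)) +
        (Matrix.fromRows (jacobianAt G x) a).rank = n := fun x hx => by
    rw [tangentAt_eq_ker_jacobianAt hrad hx, ← ker_mulVecLin_fromRows, add_comm,
      rank_add_finrank_ker_mulVecLin, Fintype.card_fin]
  have hrank : ∀ x ∈ zeroSetC F, n - i ≤ (Matrix.fromRows (jacobianAt G x) a).rank :=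
    fun x hx => by
      have h := rank_add_finrank_ker_vecMulLinear (Matrix.fromRows (jacobianAt G x) a)
      have := hN x (mem_zeroSetC_iff.1 hx)
      simp only [Fintype.card_sum, Fintype.card_fin] at h
      omega
  have hdeg : ∀ x, x ∈ degeneracyLocus G a ↔
      x ∈ zeroSetC F ∧ (Matrix.fromRows (jacobianAt G x) a).rank ≤ n - i := fun x => by
    rw [mem_degeneracyLocus_iff, mem_zeroSetC_iff, Fintype.card_fin, Fintype.card_fin]
    refine and_congr_right fun _ => ?_
    omega
  have hsigma : SigmaStr F a i = degeneracyLocus G a := by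
    ext x
    rw [hdeg, SigmaStr, Set.mem_ofPred_eq, hsmooth]
    refine and_congr_right fun hx => ?_
    have := hfin x hx
    have := hrank x hx
    omega
  have hW : Wclassic F a (n - i) ∩ SregC F = degeneracyLocus G a := by
    have h : {x | x ∈ SregC F ∧ (Matrix.fromRows (jacC F x) a).rank ≤ n - i} =
        degeneracyLocus G a := by
      ext x
      rw [hdeg, Set.mem_ofPred_eq, hsmooth, jacC_eq_jacobianAt]
    rw [Wclassic, h]
    refine Set.Subset.antisymm (fun x hx => zcl_degeneracyLocus_subset G a hx.1) fun x hx =>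
      ⟨fun f hf => hf x hx, hsmooth ▸ ((hdeg x).1 hx).1⟩
  refine ⟨?_, fun j hj _ => ?_, hW.trans hsigma.symm, Or.inr ?_⟩
  · obtain ⟨x, hx⟩ := hSne
    have hx' := mem_zeroSetC_iff.1 hx
    have hinj : Function.Injective a.vecMulLinear := by
      rw [← LinearMap.ker_eq_bot, LinearMap.ker_eq_bot']
      exact fun v hv => vecMul_eq_zero_of_isTransversal ha₁
        (by simp only [Fintype.card_fin]; omega) hx' (hJ x hx') hv
    have h := rank_add_finrank_ker_vecMulLinear a
    rwa [LinearMap.ker_eq_bot.2 hinj, finrank_bot, add_zero, Fintype.card_fin] at h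
  · refine Set.eq_empty_of_forall_notMem fun x hx => ?_
    have hx0 : x ∈ zeroSetC F := hx.1.1
    have h1 := hfin x hx0
    have h2 := hrank x hx0
    rw [hx.2] at h1
    omega
  · rw [hW]
    exact degeneracyLocus_isPureDim (by rw [Fintype.card_fin]) (by rw [Fintype.card_fin]; omega)
      ha₁ hJ hN
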